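/- If f : Y → X is a map of affinoid varieties and Σ ⊆ Y is subanalytic, then f(Σ) ⊆ X is subanalytic. In particular, the image f(Y) of any map of affinoid varieties is a subanalytic subset of X. -/

import Mathlib

/-!  Prelude: rigid-analytic basics over a complete non-archimedean
algebraically closed field `K`. -/

open scoped BoundedContinuousFunction

noncomputable section

namespace RigidQE

variable (K : Type) [NormedField K] [CompleteSpace K] [IsAlgClosed K] [IsUltrametricDist K]

/-- The valuation ring `R = {x : K | ‖x‖ ≤ 1}` of `K`. -/
def Ro : Subring K where
  carrier := {x | ‖x‖ ≤ 1}
  zero_mem' := by simp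
  one_mem' := by simp
  add_mem' := fun {a b} ha hb => le_trans (IsUltrametricDist.norm_add_le_max a b) (max_le ha hb)
  neg_mem' := fun {a} ha => by simpa using ha
  mul_mem' := fun {a b} ha hb => le_trans (norm_mul_le a b)
    (by simpa using mul_le_one₀ ha (norm_nonneg b) hb)

/-- The maximal ideal `℘ = {x : K | ‖x‖ < 1}` of the valuation ring. -/
def RoMax : Ideal (Ro K) where
  carrier := {x | ‖(x : K)‖ < 1}
  zero_mem' := by simp
  add_mem' := fun {a b} ha hb =>
    lt_of_le_of_lt (IsUltrametricDist.norm_add_le_max (a : K) (b : K)) (max_lt ha hb)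
  smul_mem' := fun c x hx => by
    have h1 : ‖(c : K)‖ ≤ 1 := c.2
    have : ‖(c : K) * (x : K)‖ ≤ 1 * ‖(x : K)‖ := le_trans (norm_mul_le _ _) (by gcongr)
    simpa using lt_of_le_of_lt (by simpa using this) hx

/-- The closed unit polydisc `R^m ⊆ K^m`. -/
def UnitBall (m : ℕ) : Set (Fin m → K) := {x | ∀ i, ‖x i‖ ≤ 1}

/-- The `i`-th coordinate function on the unit polydisc, as a bounded continuous function. -/
def coordFn (m : ℕ) (i : Fin m) : (UnitBall K m) →ᵇ K :=
  BoundedContinuousFunction.ofNormedAddCommGroup (fun x => x.1 i)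
    ((continuous_apply i).comp continuous_subtype_val) 1 (fun x => x.2 i)

/-- The Tate algebra `K⟨S₁,…,Sₘ⟩` of strictly convergent power series, realised concretely
as the closure, with respect to the supremum norm, of the algebra of polynomial functions
on the unit polydisc. -/
def TateAlg (m : ℕ) : Subalgebra K ((UnitBall K m) →ᵇ K) :=
  (Algebra.adjoin K (Set.range (coordFn K m))).topologicalClosure

end RigidQE

end

noncomputable section
namespace RigidQE

variable (K : Type) [NormedField K] [CompleteSpace K] [IsAlgClosed K] [IsUltrametricDist K]

/-- The projection `R^{m+N} → R^m` on the first `m` coordinates. -/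
def ballProj (m N : ℕ) (z : UnitBall K (m + N)) : UnitBall K m :=
  ⟨fun i => z.1 (Fin.castAdd N i), fun i => z.2 _⟩

lemma ballProj_continuous (m N : ℕ) : Continuous (ballProj K m N) := by
  apply Continuous.subtype_mk
  exact continuous_pi fun i => (continuous_apply _).comp continuous_subtype_val

/-- Pullback of bounded functions along the projection of polydiscs. -/
def ballPull (m N : ℕ) : ((UnitBall K m) →ᵇ K) →ₐ[K] ((UnitBall K (m + N)) →ᵇ K) where
  toFun f := f.compContinuous ⟨ballProj K m N, ballProj_continuous K m N⟩
  map_one' := by ext z; simp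
  map_mul' f g := by ext z; simp
  map_zero' := by ext z; simp
  map_add' f g := by ext z; simp
  commutes' c := by ext z; simp

lemma ballPull_lipschitz (m N : ℕ) : LipschitzWith 1 (ballPull K m N) := by
  apply LipschitzWith.of_dist_le_mul
  intro f g
  simp only [NNReal.coe_one, one_mul]
  refine (BoundedContinuousFunction.dist_le (dist_nonneg (x := f) (y := g))).2 ?_
  intro z
  exact BoundedContinuousFunction.dist_coe_le_dist (f := f) (g := g) (ballProj K m N z)

lemma ballPull_mem_TateAlg (m N : ℕ) {f : (UnitBall K m) →ᵇ K} (hf : f ∈ TateAlg K m) :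
    ballPull K m N f ∈ TateAlg K (m + N) := by
  have hsub : (ballPull K m N) '' (Algebra.adjoin K (Set.range (coordFn K m)) : Set _)
      ⊆ (Algebra.adjoin K (Set.range (coordFn K (m + N))) : Set _) := by
    rintro g ⟨g', hg', rfl⟩
    have : ballPull K m N g' ∈ (Algebra.adjoin K (Set.range (coordFn K m))).map
        (ballPull K m N) := Subalgebra.mem_map.2 ⟨g', hg', rfl⟩
    rw [AlgHom.map_adjoin] at this
    refine Algebra.adjoin_mono ?_ this
    rintro h ⟨h', ⟨i, rfl⟩, rfl⟩
    exact ⟨Fin.castAdd N i, by ext z; rfl⟩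
  have := (image_closure_subset_closure_image (s := (Algebra.adjoin K (Set.range (coordFn K m)) :
      Set _)) (ballPull_lipschitz K m N).continuous) (Set.mem_image_of_mem _ hf)
  exact closure_mono hsub this

/-- An affinoid variety, realised concretely as the zero locus, inside a closed unit
polydisc, of a set of strictly convergent power series. -/
structure Affinoid where
  m : ℕ
  carrier : Set (UnitBall K m)
  isZeroLocus : ∃ S : Set ((UnitBall K m) →ᵇ K),
    (∀ f ∈ S, f ∈ TateAlg K m) ∧ carrier = {x | ∀ f ∈ S, f x = 0}

variable {K}

/-- Restriction of (bounded continuous) functions on the polydisc to a subset, as plain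
functions. -/
def resHom {m : ℕ} (Z : Set (UnitBall K m)) : ((UnitBall K m) →ᵇ K) →ₐ[K] (Z → K) where
  toFun f := fun z => f z.1
  map_one' := rfl
  map_mul' f g := rfl
  map_zero' := rfl
  map_add' f g := rfl
  commutes' c := rfl

/-- The affinoid algebra of `X`, realised concretely as the algebra of functions on `X`
which are restrictions of strictly convergent power series.  (Since `K` is algebraically
closed, this faithfully represents the reduced affinoid algebra.) -/
def Affinoid.O (X : Affinoid K) : Subalgebra K (X.carrier → K) :=
  (TateAlg K X.m).map (resHom X.carrier)

/-- A basic semianalytic subset of an affinoid variety. -/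
def IsBasicSemianalytic (X : Affinoid K) (S : Set X.carrier) : Prop :=
  ∃ (mm n : ℕ) (p q : Fin mm → X.O), n ≤ mm ∧
    S = {x | (∀ i : Fin mm, (i : ℕ) < n → ‖(p i : X.carrier → K) x‖ ≤ ‖(q i : X.carrier → K) x‖)
      ∧ (∀ i : Fin mm, n ≤ (i : ℕ) → ‖(p i : X.carrier → K) x‖ < ‖(q i : X.carrier → K) x‖)}

/-- A semianalytic subset of an affinoid variety: a finite union of basic sets. -/
def IsSemianalytic (X : Affinoid K) (S : Set X.carrier) : Prop :=
  ∃ (k : ℕ) (B : Fin k → Set X.carrier),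
    (∀ j, IsBasicSemianalytic X (B j)) ∧ S = ⋃ j, B j

variable (K)

/-- The product `X × R^N` of an affinoid variety with a closed unit polydisc. -/
def Affinoid.prod (X : Affinoid K) (N : ℕ) : Affinoid K where
  m := X.m + N
  carrier := {z | ballProj K X.m N z ∈ X.carrier}
  isZeroLocus := by
    obtain ⟨S, hS, hXS⟩ := X.isZeroLocus
    refine ⟨(ballPull K X.m N) '' S, ?_, ?_⟩
    · rintro f ⟨f', hf', rfl⟩
      exact ballPull_mem_TateAlg K X.m N (hS f' hf')
    · ext z
      simp only [Set.mem_setOf_eq, hXS, Set.forall_mem_image]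
      rfl

variable {K}

/-- The projection map `X × R^N → X` on points. -/
def Affinoid.projFun (X : Affinoid K) (N : ℕ) (z : (X.prod K N).carrier) : X.carrier :=
  ⟨ballProj K X.m N z.1, z.2⟩

/-- A subanalytic subset of an affinoid variety: the image of a semianalytic subset of
`X × R^N` under the projection `X × R^N → X`. -/
def IsSubanalytic (X : Affinoid K) (S : Set X.carrier) : Prop :=
  ∃ (N : ℕ) (T : Set (X.prod K N).carrier),
    IsSemianalytic (X.prod K N) T ∧ S = (X.projFun N) '' T

end RigidQE
end

noncomputable section
namespace RigidQE

variable {K : Type} [NormedField K] [CompleteSpace K] [IsAlgClosed K] [IsUltrametricDist K]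

/-- A map of affinoid varieties: a map on points which pulls analytic functions back to
analytic functions (equivalently, a map induced by a `K`-algebra morphism of the
corresponding affinoid algebras). -/
structure AffinoidMap (Y X : Affinoid K) where
  toFun : Y.carrier → X.carrier
  pullback : ∀ p : X.O, (fun y => (p : X.carrier → K) (toFun y)) ∈ Y.O

/-- The `K`-algebra morphism of affinoid algebras corresponding to a map of affinoid
varieties. -/
def AffinoidMap.algHom {Y X : Affinoid K} (f : AffinoidMap Y X) : X.O →ₐ[K] Y.O where
  toFun p := ⟨fun y => (p : X.carrier → K) (f.toFun y), f.pullback p⟩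
  map_one' := by ext y; simp
  map_mul' p q := by ext y; simp
  map_zero' := by ext y; simp
  map_add' p q := by ext y; simp
  commutes' c := by ext y; simp

/-- A map of affinoid varieties is flat if the corresponding morphism of affinoid algebras
is flat. -/
def AffinoidMap.Flat {Y X : Affinoid K} (f : AffinoidMap Y X) : Prop :=
  RingHom.Flat f.algHom.toRingHom

open Classical in
/-- The truncated division function `D` of Denef–van den Dries:
`D (a, b) = a / b` if `‖a‖ ≤ ‖b‖ ≠ 0`, and `D (a, b) = 0` otherwise. -/
def Ddiv (a b : K) : K := if ‖a‖ ≤ ‖b‖ ∧ b ≠ 0 then a / b else 0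

/-- The point `(x, t) ∈ X × R^N` determined by `x ∈ X` and `t ∈ R^N`. -/
def extendPt (X : Affinoid K) (N : ℕ) (x : X.carrier) (t : Fin N → K)
    (ht : ∀ i, ‖t i‖ ≤ 1) : (X.prod K N).carrier := by
  have hmem : Fin.append (fun i => x.1.1 i) t ∈ UnitBall K (X.m + N) := by
    intro j
    refine Fin.addCases (motive := fun j => ‖Fin.append (fun i => x.1.1 i) t j‖ ≤ 1)
      (fun i => ?_) (fun i => ?_) j
    · simp only [Fin.append_left]; exact x.1.2 i
    · simp only [Fin.append_right]; exact ht i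
  refine ⟨⟨Fin.append (fun i => x.1.1 i) t, hmem⟩, ?_⟩
  show ballProj K X.m N ⟨Fin.append (fun i => x.1.1 i) t, hmem⟩ ∈ X.carrier
  have h : ballProj K X.m N ⟨Fin.append (fun i => x.1.1 i) t, hmem⟩ = x.1 := by
    apply Subtype.ext; funext i
    show Fin.append (fun i => x.1.1 i) t (Fin.castAdd N i) = x.1.1 i
    rw [Fin.append_left]
  rw [h]; exact x.2

/-- The algebra `A^D` of `D`-functions on an affinoid variety `X = Sp A`: the smallest
`K`-algebra of `K`-valued functions on `X` containing `A` and closed under truncated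
division `D` and under composition with strictly convergent power series over `A`
(the latter being realised as analytic functions on `X × R^N`). -/
inductive IsDFun (X : Affinoid K) : (X.carrier → K) → Prop
  | base (p : X.O) : IsDFun X (p : X.carrier → K)
  | smul (c : K) {p : X.carrier → K} : IsDFun X p → IsDFun X (c • p)
  | add {p q : X.carrier → K} : IsDFun X p → IsDFun X q → IsDFun X (p + q)
  | mul {p q : X.carrier → K} : IsDFun X p → IsDFun X q → IsDFun X (p * q)
  | div {p q : X.carrier → K} : IsDFun X p → IsDFun X q →
      IsDFun X (fun x => Ddiv (p x) (q x))
  | comp (N : ℕ) (p : (X.prod K N).O) (q : Fin N → (X.carrier → K))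
      (hq : ∀ i, IsDFun X (q i)) (hq1 : ∀ i x, ‖q i x‖ ≤ 1) :
      IsDFun X (fun x =>
        (p : (X.prod K N).carrier → K) (extendPt X N x (fun i => q i x) (fun i => hq1 i x)))

/-- A basic `D`-semianalytic subset of an affinoid variety. -/
def IsBasicDSemianalytic (X : Affinoid K) (S : Set X.carrier) : Prop :=
  ∃ (mm n : ℕ) (p q : Fin mm → (X.carrier → K)), n ≤ mm ∧
    (∀ i, IsDFun X (p i) ∧ IsDFun X (q i)) ∧
    S = {x | (∀ i : Fin mm, (i : ℕ) < n → ‖p i x‖ ≤ ‖q i x‖)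
      ∧ (∀ i : Fin mm, n ≤ (i : ℕ) → ‖p i x‖ < ‖q i x‖)}

/-- A `D`-semianalytic subset of an affinoid variety: a finite union of basic
`D`-semianalytic sets. -/
def IsDSemianalytic (X : Affinoid K) (S : Set X.carrier) : Prop :=
  ∃ (k : ℕ) (B : Fin k → Set X.carrier),
    (∀ j, IsBasicDSemianalytic X (B j)) ∧ S = ⋃ j, B j

end RigidQE
end

noncomputable section
namespace RigidQE

open MvPolynomial
open scoped MonomialOrder

section Residue

variable (K : Type) [NormedField K] [IsUltrametricDist K]

instance isPrime_RoMax : (RoMax K).IsPrime where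
  ne_top' := by
    rw [Ideal.ne_top_iff_one]
    intro h
    have h' : ‖((1 : Ro K) : K)‖ < 1 := h
    simp at h'
  mem_or_mem' := by
    intro x y hxy
    by_contra! h
    have hx : ¬ ‖(x : K)‖ < 1 := h.1
    have hy : ¬ ‖(y : K)‖ < 1 := h.2
    have hxy' : ‖((x * y : Ro K) : K)‖ < 1 := hxy
    rw [Subring.coe_mul, norm_mul] at hxy'
    nlinarith

/-- The residue ring of an algebraically closed ultrametric field is infinite: otherwise it is
a field with `q` elements, and a root of `X ^ q - X - 1` yields a contradiction. -/
instance infinite_residue [IsAlgClosed K] : Infinite (Ro K ⧸ RoMax K) := by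
  by_contra hfin
  rw [not_infinite_iff_finite] at hfin
  classical
  have := Fintype.ofFinite (Ro K ⧸ RoMax K)
  let _ : Field (Ro K ⧸ RoMax K) := Fintype.fieldOfDomain _
  set q := Fintype.card (Ro K ⧸ RoMax K)
  have hq : 1 < q := Fintype.one_lt_card
  obtain ⟨x, hx⟩ := IsAlgClosed.exists_root
    (Polynomial.X ^ q - (Polynomial.X + Polynomial.C 1) : Polynomial K) (by
      rw [Polynomial.degree_sub_eq_left_of_degree_lt] <;>
        rw [Polynomial.degree_X_pow]
      · exact_mod_cast (by lia : q ≠ 0)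
      · rw [Polynomial.degree_X_add_C]
        exact_mod_cast hq)
  have hx' : x ^ q = x + 1 := by
    simpa [Polynomial.IsRoot.def, sub_eq_zero] using hx
  have hle : x ∈ Ro K := by
    by_contra h
    replace h : 1 < ‖x‖ := not_le.1 h
    have hxq : ‖x‖ ^ q ≤ ‖x‖ := by
      rw [← norm_pow, hx']
      exact (IsUltrametricDist.norm_add_le_max _ _).trans (by simp [h.le])
    exact absurd (lt_self_pow₀ h hq) hxq.not_gt
  have h2 : (⟨x, hle⟩ : Ro K) ^ q = ⟨x, hle⟩ + 1 := Subtype.ext hx'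
  have h3 := congrArg (Ideal.Quotient.mk (RoMax K)) h2
  rw [map_pow, FiniteField.pow_card, map_add, map_one] at h3
  simp at h3

end Residue

section Gauss

variable {K : Type} [NormedField K]

lemma norm_prod_pow_le_one {m : ℕ} (x : UnitBall K m) (d : Fin m →₀ ℕ) :
    ‖∏ i, x.1 i ^ d i‖ ≤ 1 := by
  rw [norm_prod]
  refine Finset.prod_le_one (fun _ _ => norm_nonneg _) fun i _ => ?_
  rw [norm_pow]
  exact pow_le_one₀ (norm_nonneg _) (x.2 i)

/-- Some coefficient of a nonzero polynomial has the largest norm. -/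
lemma exists_norm_coeff_max {m : ℕ} {p : MvPolynomial (Fin m) K} (hp : p ≠ 0) :
    ∃ d, p.coeff d ≠ 0 ∧ ∀ e, ‖p.coeff e‖ ≤ ‖p.coeff d‖ := by
  obtain ⟨d, hd, hmax⟩ := p.support.exists_max_image (fun d => ‖p.coeff d‖)
    (support_nonempty.2 hp)
  refine ⟨d, mem_support_iff.1 hd, fun e => ?_⟩
  by_cases he : e ∈ p.support
  · exact hmax e he
  · rw [notMem_support_iff.1 he, norm_zero]
    exact norm_nonneg _

variable [IsUltrametricDist K]

lemma norm_sub_le_max_norm (a b : K) : ‖a - b‖ ≤ max ‖a‖ ‖b‖ := by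
  simpa [sub_eq_add_neg] using IsUltrametricDist.norm_add_le_max a (-b)

lemma norm_sum_mul_prod_pow_le {m : ℕ} {s : Finset (Fin m →₀ ℕ)} {a : (Fin m →₀ ℕ) → K} {C : ℝ}
    (hC : 0 ≤ C) (ha : ∀ d ∈ s, ‖a d‖ ≤ C) (x : UnitBall K m) :
    ‖∑ d ∈ s, a d * ∏ i, x.1 i ^ d i‖ ≤ C := by
  refine IsUltrametricDist.norm_sum_le_of_forall_le_of_nonneg hC fun d hd => ?_
  rw [norm_mul]
  exact (mul_le_mul (ha d hd) (norm_prod_pow_le_one x d) (norm_nonneg _) hC).trans_eq (mul_one C)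

lemma norm_eval_le {m : ℕ} {p : MvPolynomial (Fin m) K} {C : ℝ} (hC : 0 ≤ C)
    (hp : ∀ d, ‖p.coeff d‖ ≤ C) (x : UnitBall K m) : ‖eval x.1 p‖ ≤ C := by
  rw [eval_eq']
  exact norm_sum_mul_prod_pow_le hC (fun d _ => hp d) x

lemma norm_eval_map_subtype_le_one {m : ℕ} (p : MvPolynomial (Fin m) (Ro K)) (x : UnitBall K m) :
    ‖eval x.1 (map (Ro K).subtype p)‖ ≤ 1 :=
  norm_eval_le zero_le_one (fun d => by rw [coeff_map]; exact (p.coeff d).2) x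

lemma exists_map_subtype_eq {m : ℕ} {p : MvPolynomial (Fin m) K} (hp : ∀ d, ‖p.coeff d‖ ≤ 1) :
    ∃ q : MvPolynomial (Fin m) (Ro K), map (Ro K).subtype q = p := by
  refine ⟨∑ d ∈ p.support, monomial d ⟨p.coeff d, hp d⟩, ?_⟩
  conv_rhs => rw [p.as_sum]
  simp [map_monomial]

/-- The maximum modulus principle: the Gauss norm is bounded by the supremum norm. -/
lemma norm_coeff_le [IsAlgClosed K] {m : ℕ} {p : MvPolynomial (Fin m) K} {B : ℝ}
    (hp : ∀ x : UnitBall K m, ‖eval x.1 p‖ ≤ B) (d : Fin m →₀ ℕ) : ‖p.coeff d‖ ≤ B := by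
  by_cases hp0 : p = 0
  · simpa [hp0] using hp ⟨0, fun i => by simp⟩
  obtain ⟨e, he, hmax⟩ := exists_norm_coeff_max hp0
  refine (hmax d).trans ?_
  obtain ⟨q, hq⟩ := exists_map_subtype_eq (p := C (p.coeff e)⁻¹ * p) fun d => by
    rw [coeff_C_mul, norm_mul, norm_inv, inv_mul_le_one₀ (norm_pos_iff.2 he)]
    exact hmax d
  have hq1 : q.coeff e = 1 := by
    apply Subtype.ext
    have := congrArg (coeff e) hq
    rw [coeff_map, coeff_C_mul, inv_mul_cancel₀ he] at this
    exact this
  have hne : map (Ideal.Quotient.mk (RoMax K)) q ≠ 0 := by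
    intro h
    have := congrArg (coeff e) h
    simp [coeff_map, hq1] at this
  obtain ⟨xbar, hxbar⟩ : ∃ x, eval x (map (Ideal.Quotient.mk (RoMax K)) q) ≠ 0 := by
    by_contra! h
    exact hne (funext fun x => by rw [h x, map_zero])
  choose x hx using fun i => Ideal.Quotient.mk_surjective (xbar i)
  obtain rfl : (fun i => Ideal.Quotient.mk (RoMax K) (x i)) = xbar := _root_.funext hx
  have h1 : ¬ ‖((eval x q : Ro K) : K)‖ < 1 := fun h => hxbar (by
    rw [eval_map]
    refine (eval₂_comp (Ideal.Quotient.mk (RoMax K)) x q).symm.trans ?_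
    exact Ideal.Quotient.eq_zero_iff_mem.2 h)
  have h2 : ((eval x q : Ro K) : K) = (p.coeff e)⁻¹ * eval (fun i => (x i : K)) p := by
    have := congrArg (eval (fun i => (x i : K))) hq
    rw [map_mul, eval_C, eval_map] at this
    rw [← this]
    exact eval₂_comp (Ro K).subtype x q
  rw [h2, norm_mul, norm_inv, not_lt, one_le_inv_mul₀ (norm_pos_iff.2 he)] at h1
  exact h1.trans (hp ⟨fun i => x i, fun i => (x i).2⟩)

end Gauss

section Noetherian

variable {K : Type} [NormedField K] {m : ℕ}

variable (K m) in
/-- Polynomials, viewed as elements of the Tate algebra. -/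
def polyToTate : MvPolynomial (Fin m) K →ₐ[K] TateAlg K m :=
  aeval fun i => ⟨coordFn K m i,
    Subalgebra.le_topologicalClosure _ (Algebra.subset_adjoin ⟨i, rfl⟩)⟩

lemma polyToTate_apply (p : MvPolynomial (Fin m) K) (x : UnitBall K m) :
    (polyToTate K m p).1 x = eval x.1 p := by
  induction p using MvPolynomial.induction_on with
  | C a => simp [polyToTate, Algebra.algebraMap_eq_smul_one]
  | add p q hp hq => simp [hp, hq]
  | mul_X p i hp =>
    rw [map_mul, map_mul, eval_X, ← hp, polyToTate, aeval_X]
    rfl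

lemma exists_poly_approx (f : TateAlg K m) {ε : ℝ} (hε : 0 < ε) :
    ∃ p : MvPolynomial (Fin m) K, ∀ x : UnitBall K m, ‖f.1 x - eval x.1 p‖ ≤ ε := by
  obtain ⟨g, hg, hfg⟩ := Metric.mem_closure_iff.1
    (show f.1 ∈ closure (Algebra.adjoin K (Set.range (coordFn K m)) : Set _) from f.2) ε hε
  rw [Algebra.adjoin_range_eq_range_aeval] at hg
  obtain ⟨p, rfl⟩ := hg
  refine ⟨p, fun x => ?_⟩
  have hp : aeval (coordFn K m) p = (polyToTate K m p).1 := by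
    rw [← Subalgebra.coe_val, ← AlgHom.comp_apply]
    congr 1
    ext i : 1
    simp [polyToTate]
  rw [← polyToTate_apply, ← hp, ← dist_eq_norm]
  exact (BoundedContinuousFunction.dist_coe_le_dist x).trans hfg.le

lemma exists_uniform_bound_lt_one {α : Type*} (s : Finset α) (u : α → ℝ)
    (hu : ∀ a ∈ s, u a < 1) : ∃ δ : ℝ, 0 < δ ∧ δ < 1 ∧ ∀ a ∈ s, u a ≤ δ := by
  classical
  induction s using Finset.induction_on with
  | empty => exact ⟨1 / 2, by norm_num, by norm_num, by simp⟩
  | insert a s _ ih =>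
    obtain ⟨δ, h0, h1, hδ⟩ := ih fun b hb => hu b (Finset.mem_insert_of_mem hb)
    refine ⟨max δ (u a), lt_max_of_lt_left h0, max_lt h1 (hu a (Finset.mem_insert_self _ _)), ?_⟩
    intro b hb
    rcases Finset.mem_insert.1 hb with rfl | hb
    · exact le_max_right _ _
    · exact (hδ b hb).trans (le_max_left _ _)

/-- Among the exponents of a nonzero polynomial whose coefficient has the largest norm, there is
one that is largest for the lexicographic order. -/
lemma exists_leading_coeff {p : MvPolynomial (Fin m) K} (hp : p ≠ 0) :
    ∃ d, p.coeff d ≠ 0 ∧ (∀ e, ‖p.coeff e‖ ≤ ‖p.coeff d‖) ∧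
      ∀ e, d ≺[MonomialOrder.lex] e → ‖p.coeff e‖ < ‖p.coeff d‖ := by
  obtain ⟨d₀, hd₀, hmax⟩ := exists_norm_coeff_max hp
  obtain ⟨d, hd, hdmax⟩ := (p.support.filter fun d => ‖p.coeff d₀‖ ≤ ‖p.coeff d‖).exists_max_image
    (MonomialOrder.lex (σ := Fin m)).toSyn
    ⟨d₀, Finset.mem_filter.2 ⟨mem_support_iff.2 hd₀, le_rfl⟩⟩
  rw [Finset.mem_filter, mem_support_iff] at hd
  refine ⟨d, hd.1, fun e => (hmax e).trans hd.2, fun e he => ?_⟩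
  by_contra! h
  have hle := hd.2.trans h
  refine (hdmax e (Finset.mem_filter.2 ⟨mem_support_iff.2 ?_, hle⟩)).not_gt he
  exact norm_pos_iff.1 ((norm_pos_iff.2 hd₀).trans_le hle)

variable [IsUltrametricDist K]

/-- `q` is an approximate leading part of `g`: the polynomial `q` over the valuation ring is monic
for the lexicographic order, and `g - q` has norm at most `δ`. -/
structure IsLeadingPart (g : TateAlg K m) (q : MvPolynomial (Fin m) (Ro K)) (δ : ℝ) : Prop where
  monic : MonomialOrder.lex.Monic q
  norm_sub_le : ∀ x : UnitBall K m, ‖g.1 x - eval x.1 (map (Ro K).subtype q)‖ ≤ δ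

/-- The set of exponents of leading parts of elements of an ideal of the Tate algebra. -/
def leadingExps (I : Ideal (TateAlg K m)) : Set (Fin m →₀ ℕ) :=
  {d | ∃ g ∈ I, ∃ q, MonomialOrder.lex.degree q = d ∧ ∃ δ < 1, IsLeadingPart g q δ}

/-- If a polynomial approximates an element of `I` better than the size of one of its
coefficients, then it involves a leading exponent of `I`. -/
lemma exists_mem_support_leadingExps {I : Ideal (TateAlg K m)} {f : TateAlg K m} (hf : f ∈ I)
    {r : MvPolynomial (Fin m) K} {ε : ℝ} (hfr : ∀ x : UnitBall K m, ‖f.1 x - eval x.1 r‖ ≤ ε)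
    {e : Fin m →₀ ℕ} (he : ε < ‖r.coeff e‖) : ∃ d ∈ leadingExps I, d ∈ r.support := by
  have hε : 0 ≤ ε := (norm_nonneg _).trans (hfr ⟨0, fun i => by simp⟩)
  have hr : r ≠ 0 := by
    rintro rfl
    simp only [coeff_zero, norm_zero] at he
    exact he.not_ge hε
  obtain ⟨d, hd, hmax, hlt⟩ := exists_leading_coeff hr
  have hd0 : 0 < ‖r.coeff d‖ := norm_pos_iff.2 hd
  set c := r.coeff d
  have hc (e) : ‖c⁻¹ * r.coeff e‖ ≤ 1 := by
    rw [norm_mul, norm_inv, inv_mul_le_one₀ hd0]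
    exact hmax e
  have hclt (e) (he : d ≺[MonomialOrder.lex] e) : ‖c⁻¹ * r.coeff e‖ < 1 := by
    rw [norm_mul, norm_inv, inv_mul_lt_one₀ hd0]
    exact hlt e he
  set s := r.support.filter fun e => e ≼[MonomialOrder.lex] d
  have hds : d ∈ s := Finset.mem_filter.2 ⟨mem_support_iff.2 hd, le_rfl⟩
  set q : MvPolynomial (Fin m) (Ro K) := ∑ e ∈ s, monomial e ⟨c⁻¹ * r.coeff e, hc e⟩ with hq
  have hqcoeff (e) : q.coeff e = if e ∈ s then ⟨c⁻¹ * r.coeff e, hc e⟩ else 0 := by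
    classical
    simp [hq, coeff_sum, coeff_monomial]
  have hqd : q.coeff d = 1 := by
    rw [hqcoeff, if_pos hds]
    exact Subtype.ext (inv_mul_cancel₀ hd)
  have hdeg : MonomialOrder.lex.degree q = d := by
    apply (MonomialOrder.lex (σ := Fin m)).toSyn.injective
    refine le_antisymm (MonomialOrder.lex.degree_le_iff.2 fun e he => ?_)
      (MonomialOrder.lex.le_degree (mem_support_iff.2 (by rw [hqd]; exact one_ne_zero)))
    by_contra h
    rw [mem_support_iff, hqcoeff, if_neg] at he
    · exact he rfl
    · exact fun hes => h (Finset.mem_filter.1 hes).2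
  obtain ⟨δ, hδ0, hδ1, hδ⟩ := exists_uniform_bound_lt_one
    (r.support.filter fun e => ¬ e ≼[MonomialOrder.lex] d) (fun e => ‖c⁻¹ * r.coeff e‖)
    fun e he => hclt e (not_le.1 (Finset.mem_filter.1 he).2)
  refine ⟨d, ⟨algebraMap K _ c⁻¹ * f, I.mul_mem_left _ hf, q, hdeg, max (ε / ‖c‖) δ,
    max_lt ?_ hδ1, ?_, fun x => ?_⟩, mem_support_iff.2 hd⟩
  · rw [div_lt_one hd0]
    exact he.trans_le (hmax e)
  · rw [MonomialOrder.Monic, MonomialOrder.leadingCoeff, hdeg, hqd]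
  · have hqx : eval x.1 (map (Ro K).subtype q) =
        ∑ e ∈ s, c⁻¹ * r.coeff e * ∏ i, x.1 i ^ e i := by
      simp only [hq, map_sum, map_monomial, eval_monomial, Finsupp.prod_pow]
      rfl
    have hrx : c⁻¹ * eval x.1 r - eval x.1 (map (Ro K).subtype q) =
        ∑ e ∈ r.support.filter (fun e => ¬ e ≼[MonomialOrder.lex] d),
          c⁻¹ * r.coeff e * ∏ i, x.1 i ^ e i := by
      rw [hqx, sub_eq_iff_eq_add', Finset.sum_filter_add_sum_filter_not, eval_eq',
        Finset.mul_sum]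
      simp only [mul_assoc]
    have hsplit : (algebraMap K (TateAlg K m) c⁻¹ * f).1 x - eval x.1 (map (Ro K).subtype q) =
        c⁻¹ * (f.1 x - eval x.1 r) + (c⁻¹ * eval x.1 r - eval x.1 (map (Ro K).subtype q)) := by
      have : (algebraMap K (TateAlg K m) c⁻¹ * f).1 x = c⁻¹ * f.1 x := by
        rw [← Algebra.smul_def]
        rfl
      rw [this]
      ring
    rw [hsplit, hrx]
    refine (IsUltrametricDist.norm_add_le_max _ _).trans (max_le_max ?_ ?_)
    · rw [norm_mul, norm_inv, inv_mul_eq_div]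
      gcongr
      exact hfr x
    · exact norm_sum_mul_prod_pow_le hδ0.le hδ x

/-- The division step: modulo elements of `I` whose leading exponents generate all leading
exponents of `I`, an element of `I` becomes smaller by a uniform factor. -/
lemma exists_norm_sub_sum_le [IsAlgClosed K] {I : Ideal (TateAlg K m)} {ι : Type*} [Fintype ι]
    {g : ι → TateAlg K m} {q : ι → MvPolynomial (Fin m) (Ro K)} {δ : ℝ} (hδ0 : 0 < δ)
    (hδ1 : δ < 1) (hg : ∀ i, g i ∈ I) (hgq : ∀ i, IsLeadingPart (g i) (q i) δ)
    (hI : ∀ d ∈ leadingExps I, ∃ i, MonomialOrder.lex.degree (q i) ≤ d)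
    {f : TateAlg K m} (hf : f ∈ I) {B : ℝ} (hB : 0 < B) (hfB : ∀ x, ‖f.1 x‖ ≤ B) :
    ∃ h : ι → TateAlg K m, ∀ x, ‖(f - ∑ i, h i * g i).1 x‖ ≤ δ * B := by
  have hδB : 0 < δ * B := mul_pos hδ0 hB
  have hδB' : δ * B ≤ B := mul_le_of_le_one_left hB.le hδ1.le
  obtain ⟨p, hp⟩ := exists_poly_approx f hδB
  have hpB (d) : ‖p.coeff d‖ ≤ B := norm_coeff_le (fun x => by
    have h := norm_sub_le_max_norm (f.1 x) (f.1 x - eval x.1 p)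
    rw [sub_sub_cancel] at h
    exact h.trans (max_le (hfB x) ((hp x).trans hδB'))) d
  by_cases hp0 : p = 0
  · refine ⟨0, fun x => ?_⟩
    have := hp x
    rw [hp0, map_zero, sub_zero] at this
    simpa using this
  obtain ⟨e, he, hmax⟩ := exists_norm_coeff_max hp0
  have he0 : 0 < ‖p.coeff e‖ := norm_pos_iff.2 he
  set c := p.coeff e
  obtain ⟨p', hp'⟩ := exists_map_subtype_eq (p := C c⁻¹ * p) fun d => by
    rw [coeff_C_mul, norm_mul, norm_inv, inv_mul_le_one₀ he0]
    exact hmax d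
  obtain ⟨a, r, hpr, -, hr⟩ := MonomialOrder.lex.div (b := q)
    (fun i => by rw [(hgq i).monic]; exact isUnit_one) p'
  set φ := map (σ := Fin m) (Ro K).subtype
  have hpcr : p = ∑ i, C c * φ (a i) * φ (q i) + C c * φ r := by
    have h1 : p = C c * φ p' := by
      rw [hp', ← mul_assoc, ← C_mul, mul_inv_cancel₀ he, C_1, one_mul]
    rw [h1, hpr, Finsupp.linearCombination_apply, Finsupp.sum_fintype _ _ (by simp), map_add, map_sum, mul_add, Finset.mul_sum]
    simp [mul_assoc]
  set h : ι → TateAlg K m := fun i => polyToTate K m (C c * φ (a i))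
  set f' := f - ∑ i, h i * g i with hf'
  have hf'I : f' ∈ I := I.sub_mem hf (I.sum_mem fun i _ => I.mul_mem_left _ (hg i))
  have hf'r (x : UnitBall K m) : ‖f'.1 x - eval x.1 (C c * φ r)‖ ≤ δ * B := by
    have hsum : (∑ i, h i * g i).1 x = ∑ i, eval x.1 (C c * φ (a i)) * (g i).1 x := by
      simp [h, polyToTate_apply]
    have hsplit : f'.1 x - eval x.1 (C c * φ r) = (f.1 x - eval x.1 p) -
        ∑ i, eval x.1 (C c * φ (a i)) * ((g i).1 x - eval x.1 (φ (q i))) := by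
      have : f'.1 x = f.1 x - (∑ i, h i * g i).1 x := rfl
      rw [this, hsum, hpcr]
      simp only [map_add, map_sum, map_mul, mul_sub, Finset.sum_sub_distrib]
      ring
    rw [hsplit]
    refine (norm_sub_le_max_norm _ _).trans (max_le (hp x) ?_)
    refine IsUltrametricDist.norm_sum_le_of_forall_le_of_nonneg hδB.le fun i _ => ?_
    rw [map_mul, eval_C, norm_mul, norm_mul, mul_comm δ B]
    refine mul_le_mul ?_ ((hgq i).norm_sub_le x) (norm_nonneg _) hB.le
    exact (mul_le_of_le_one_right (norm_nonneg _) (norm_eval_map_subtype_le_one _ x)).trans (hpB e)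
  have hrB (d) : ‖(C c * φ r).coeff d‖ ≤ δ * B := by
    by_contra! hlt
    obtain ⟨d, hdI, hd⟩ := exists_mem_support_leadingExps hf'I hf'r hlt
    obtain ⟨i, hi⟩ := hI d hdI
    refine hr d (mem_support_iff.2 fun h0 => ?_) i hi
    rw [mem_support_iff, coeff_C_mul, coeff_map, h0, map_zero, mul_zero] at hd
    exact hd rfl
  refine ⟨h, fun x => ?_⟩
  have := IsUltrametricDist.norm_add_le_max (f'.1 x - eval x.1 (C c * φ r))
    (eval x.1 (C c * φ r))
  rw [sub_add_cancel] at this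
  exact this.trans (max_le (hf'r x) (norm_eval_le hδB.le hrB x))

/-- Zero loci of ideals of the Tate algebra are cut out by finitely many elements. -/
theorem exists_finset_zeroLocus [IsAlgClosed K] (I : Ideal (TateAlg K m)) :
    ∃ G : Finset (TateAlg K m), (∀ g ∈ G, g ∈ I) ∧
      ∀ y, (∀ g ∈ G, g.1 y = 0) → ∀ f ∈ I, f.1 y = 0 := by
  classical
  set M := {d | Minimal (· ∈ leadingExps I) d}
  have hM : M.Finite :=
    WellQuasiOrderedLE.finite_of_isAntichain (setOfPred_minimal_antichain (· ∈ leadingExps I))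
  have := hM.fintype
  choose g hgI q hqd ε hε hgq using fun d : M => (d.2.1 : (d : Fin m →₀ ℕ) ∈ leadingExps I)
  obtain ⟨δ, hδ0, hδ1, hδ⟩ := exists_uniform_bound_lt_one Finset.univ ε fun d _ => hε d
  have hstep := fun f hf B => exists_norm_sub_sum_le (I := I) (f := f) (B := B) hδ0 hδ1 hgI
    (fun d => ⟨(hgq d).monic, fun x => ((hgq d).norm_sub_le x).trans (hδ d (Finset.mem_univ d))⟩)
    (fun d hd => by
      obtain ⟨b, hbd, hb⟩ := exists_minimal_le_of_wellFoundedLT (· ∈ leadingExps I) d hd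
      exact ⟨⟨b, hb⟩, by rwa [hqd]⟩) hf
  refine ⟨Finset.univ.image g, Finset.forall_mem_image.2 fun d _ => hgI d, fun y hy f hf => ?_⟩
  have hgy (d) : (g d).1 y = 0 := hy _ (Finset.mem_image_of_mem _ (Finset.mem_univ d))
  have hpow (n : ℕ) : ∀ f ∈ I, ∀ B > 0, (∀ x, ‖f.1 x‖ ≤ B) → ‖f.1 y‖ ≤ δ ^ n * B := by
    induction n with
    | zero => exact fun f _ B _ hfB => by simpa using hfB y
    | succ n ih =>
      intro f hf B hB hfB
      obtain ⟨h, hh⟩ := hstep f hf B hB hfB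
      have := ih _ (I.sub_mem hf (I.sum_mem fun d _ => I.mul_mem_left (h d) (hgI d)))
        (δ * B) (mul_pos hδ0 hB) hh
      have hfy : (f - ∑ d, h d * g d).1 y = f.1 y := by simp [hgy]
      rwa [hfy, ← mul_assoc, ← pow_succ] at this
  have hlim : Filter.Tendsto (fun n : ℕ => δ ^ n * (‖f.1‖ + 1)) Filter.atTop (nhds 0) := by
    simpa using (tendsto_pow_atTop_nhds_zero_of_lt_one hδ0.le hδ1).mul_const (‖f.1‖ + 1)
  have hle := ge_of_tendsto' hlim fun n => hpow n f hf (‖f.1‖ + 1) (by positivity) fun x =>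
    (f.1.norm_coe_le_norm x).trans (by simp)
  exact norm_le_zero_iff.1 hle

end Noetherian

section Semianalytic

variable {K : Type} [NormedField K]

/-- The elements of `X.O` are the restrictions of elements of the Tate algebra. -/
def Affinoid.res (X : Affinoid K) (F : TateAlg K X.m) : X.O :=
  ⟨resHom X.carrier F.1, Subalgebra.mem_map.2 ⟨F.1, F.2, rfl⟩⟩

lemma Affinoid.res_apply (X : Affinoid K) (F : TateAlg K X.m) (x : X.carrier) :
    (X.res F : X.carrier → K) x = F.1 x.1 := rfl

lemma Affinoid.exists_res_eq (X : Affinoid K) (p : X.O) : ∃ F, X.res F = p := by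
  obtain ⟨F, hF, hFp⟩ := Subalgebra.mem_map.1 p.2
  exact ⟨⟨F, hF⟩, Subtype.ext hFp⟩

lemma Affinoid.exists_coord (X : Affinoid K) (i : Fin X.m) :
    ∃ c : X.O, ∀ x, (c : X.carrier → K) x = x.1.1 i :=
  ⟨X.res (polyToTate K X.m (MvPolynomial.X i)), fun x =>
    (polyToTate_apply _ x.1).trans (eval_X i)⟩

/-- The map of polydiscs that reindexes coordinates. -/
def ballReindex {a b : ℕ} (σ : Fin a → Fin b) (z : UnitBall K b) : UnitBall K a :=
  ⟨fun i => z.1 (σ i), fun i => z.2 (σ i)⟩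

lemma exists_tate_ballReindex {a b : ℕ} (σ : Fin a → Fin b) (F : TateAlg K a) :
    ∃ G : TateAlg K b, ∀ z, G.1 z = F.1 (ballReindex σ z) := by
  have hcont : Continuous (ballReindex (K := K) σ) := by
    refine Continuous.subtype_mk (continuous_pi fun i => ?_) _
    exact (continuous_apply (σ i)).comp continuous_subtype_val
  let φ : ((UnitBall K a) →ᵇ K) →ₐ[K] ((UnitBall K b) →ᵇ K) :=
    { toFun := fun f => f.compContinuous ⟨_, hcont⟩
      map_one' := rfl
      map_mul' := fun _ _ => rfl
      map_zero' := rfl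
      map_add' := fun _ _ => rfl
      commutes' := fun _ => rfl }
  have hφ : Continuous φ := BoundedContinuousFunction.continuous_compContinuous ⟨_, hcont⟩
  refine ⟨⟨φ F.1, ?_⟩, fun z => rfl⟩
  refine map_mem_closure hφ F.2 fun f hf => ?_
  have hmem : φ f ∈ (Algebra.adjoin K (Set.range (coordFn K a))).map φ :=
    Subalgebra.mem_map.2 ⟨f, hf, rfl⟩
  rw [AlgHom.map_adjoin] at hmem
  refine Algebra.adjoin_mono ?_ hmem
  rintro _ ⟨_, ⟨i, rfl⟩, rfl⟩
  exact ⟨σ i, rfl⟩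

lemma IsBasicSemianalytic.inter_norm_le {X : Affinoid K} {S : Set X.carrier}
    (hS : IsBasicSemianalytic X S) (p q : X.O) :
    IsBasicSemianalytic X
      (S ∩ {x | ‖(p : X.carrier → K) x‖ ≤ ‖(q : X.carrier → K) x‖}) := by
  obtain ⟨k, n, p', q', hn, rfl⟩ := hS
  refine ⟨k + 1, n + 1, Fin.cons p p', Fin.cons q q', by lia, ?_⟩
  ext x
  simp only [Set.mem_inter_iff, Set.mem_ofPred_eq, Fin.forall_fin_succ, Fin.cons_zero,
    Fin.cons_succ, Fin.val_zero, Fin.val_succ, Nat.add_lt_add_iff_right, Nat.add_le_add_iff_right]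
  simp
  tauto

lemma IsBasicSemianalytic.inter_zeroLocus {X : Affinoid K} {S : Set X.carrier}
    (hS : IsBasicSemianalytic X S) {α : Type*} (s : Finset α) (p : α → X.O) :
    IsBasicSemianalytic X (S ∩ {x | ∀ a ∈ s, (p a : X.carrier → K) x = 0}) := by
  classical
  induction s using Finset.induction_on with
  | empty => simpa using hS
  | insert a s _ ih =>
    convert ih.inter_norm_le (p a) 0 using 1
    ext x
    simp [and_assoc, and_comm (a := (p a : X.carrier → K) x = 0)]

/-- An affinoid variety is the zero locus of finitely many strictly convergent power series. -/
lemma Affinoid.exists_finset_eq_zeroLocus [IsAlgClosed K] [IsUltrametricDist K]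
    (X : Affinoid K) :
    ∃ G : Finset (TateAlg K X.m), ∀ x, x ∈ X.carrier ↔ ∀ g ∈ G, g.1 x = 0 := by
  let I : Ideal (TateAlg K X.m) :=
    { carrier := {f | ∀ x ∈ X.carrier, f.1 x = 0}
      zero_mem' := fun _ _ => rfl
      add_mem' := fun hf hg x hx => by simp [hf x hx, hg x hx]
      smul_mem' := fun c f hf x hx => by simp [hf x hx] }
  obtain ⟨G, hGI, hG⟩ := exists_finset_zeroLocus I
  obtain ⟨S, hS, hXS⟩ := X.isZeroLocus
  refine ⟨G, fun x => ⟨fun hx g hg => hGI g hg x hx, fun hx => ?_⟩⟩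
  rw [hXS]
  intro f hf
  refine hG x hx ⟨f, hS f hf⟩ fun y hy => ?_
  rw [hXS] at hy
  exact hy f hf

variable [CompleteSpace K] [IsAlgClosed K] [IsUltrametricDist K]

lemma isSubanalytic_univ (X : Affinoid K) : IsSubanalytic X Set.univ := by
  refine ⟨0, Set.univ, ⟨1, fun _ => Set.univ, fun _ => ⟨0, 0, Fin.elim0, Fin.elim0, le_rfl, ?_⟩,
    ?_⟩, ?_⟩
  · simp
  · exact (Set.iUnion_const _).symm
  · refine (Set.eq_univ_of_forall fun x => ?_).symm
    exact ⟨extendPt X 0 x Fin.elim0 fun i => i.elim0, trivial,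
      Subtype.ext (Subtype.ext (_root_.funext fun i => Fin.append_left _ _ i))⟩

/-- The last `n` coordinates of a point of `X × R^n`. -/
def Affinoid.prodSnd (X : Affinoid K) (n : ℕ) (z : (X.prod K n).carrier) : UnitBall K n :=
  ballReindex (Fin.natAdd X.m) z.1

lemma Affinoid.exists_prodSnd_pullback (X : Affinoid K) {n : ℕ} (F : TateAlg K n) :
    ∃ G : (X.prod K n).O, ∀ z, (G : (X.prod K n).carrier → K) z = F.1 (X.prodSnd n z) := by
  obtain ⟨G, hG⟩ := exists_tate_ballReindex (b := (X.prod K n).m) (Fin.natAdd X.m) F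
  exact ⟨(X.prod K n).res G, fun z => hG z.1⟩

/-- Pulling back conditions along `X × R^n → R^n ⊇ Z`. -/
lemma IsSemianalytic.exists_prodSnd {X Z : Affinoid K} {T : Set Z.carrier}
    (hT : IsSemianalytic Z T) {α : Type*} (s : Finset α) (p : α → (X.prod K Z.m).O) :
    ∃ T' : Set (X.prod K Z.m).carrier, IsSemianalytic (X.prod K Z.m) T' ∧
      ∀ (z : (X.prod K Z.m).carrier) (hz : X.prodSnd Z.m z ∈ Z.carrier),
        z ∈ T' ↔ ⟨X.prodSnd Z.m z, hz⟩ ∈ T ∧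
          ∀ a ∈ s, (p a : (X.prod K Z.m).carrier → K) z = 0 := by
  obtain ⟨k, B, hB, rfl⟩ := hT
  choose r n p' q' hn hBeq using hB
  have hpull (F : Z.O) : ∃ G : (X.prod K Z.m).O, ∀ (z : (X.prod K Z.m).carrier)
      (hz : X.prodSnd Z.m z ∈ Z.carrier), (G : (X.prod K Z.m).carrier → K) z =
        (F : Z.carrier → K) ⟨X.prodSnd Z.m z, hz⟩ := by
    obtain ⟨F, rfl⟩ := Z.exists_res_eq F
    obtain ⟨G, hG⟩ := X.exists_prodSnd_pullback F
    exact ⟨G, fun z _ => hG z⟩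
  choose ψ hψ using hpull
  refine ⟨_, ⟨k, _, fun j => IsBasicSemianalytic.inter_zeroLocus
    ⟨r j, n j, fun i => ψ (p' j i), fun i => ψ (q' j i), hn j, rfl⟩ s p, rfl⟩, fun z hz => ?_⟩
  simp only [Set.mem_iUnion, Set.mem_inter_iff, exists_and_right, hBeq, Set.mem_ofPred_eq,
    hψ _ z hz]

end Semianalytic

/-- Images of subanalytic sets under maps of affinoid varieties are subanalytic: the graph of the
map and the equations of `Y` are finitely many conditions on `X × R^n`. -/
lemma IsSubanalytic.image {K : Type} [NormedField K] [CompleteSpace K] [IsAlgClosed K]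
    [IsUltrametricDist K] {Y X : Affinoid K} (f : AffinoidMap Y X) {S : Set Y.carrier}
    (hS : IsSubanalytic Y S) : IsSubanalytic X (f.toFun '' S) := by
  obtain ⟨N, T, hT, rfl⟩ := hS
  set Z := Y.prod K N
  set W := X.prod K Z.m
  obtain ⟨G, hG⟩ := Z.exists_finset_eq_zeroLocus
  have hcoord (i : Fin X.m) : ∃ p : W.O, ∀ (z : W.carrier) (hz : X.prodSnd Z.m z ∈ Z.carrier),
      (p : W.carrier → K) z = (X.projFun Z.m z).1.1 i -
        (f.toFun (Y.projFun N ⟨X.prodSnd Z.m z, hz⟩)).1.1 i := by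
    obtain ⟨c, hc⟩ := X.exists_coord i
    obtain ⟨F, hF⟩ := Y.exists_res_eq ⟨_, f.pullback c⟩
    obtain ⟨F', hF'⟩ := exists_tate_ballReindex (b := Z.m) (Fin.castAdd N) F
    obtain ⟨H, hH⟩ := X.exists_prodSnd_pullback F'
    obtain ⟨d, hd⟩ := W.exists_coord (Fin.castAdd Z.m i)
    refine ⟨d - H, fun z hz => ?_⟩
    have hFc := congrFun (congrArg Subtype.val hF) (Y.projFun N ⟨X.prodSnd Z.m z, hz⟩)
    replace hFc : F.1 _ = _ := hFc.trans (hc _)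
    rw [← hFc, Subalgebra.coe_sub, Pi.sub_apply, hd, hH, hF']
    rfl
  choose p hp using hcoord
  choose γ hγ using fun g : TateAlg K Z.m => X.exists_prodSnd_pullback g
  obtain ⟨T', hT', hmem⟩ := hT.exists_prodSnd (X := X) Finset.univ p
  obtain ⟨k, B, hB, rfl⟩ := hT'
  refine ⟨Z.m, _, ⟨k, _, fun j => (hB j).inter_zeroLocus G γ, rfl⟩, ?_⟩
  rw [← Set.iUnion_inter]
  ext x
  constructor
  · rintro ⟨_, ⟨w, hw, rfl⟩, rfl⟩
    set x := f.toFun (Y.projFun N w) with hx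
    set z := extendPt X Z.m x w.1.1 w.1.2
    have hz1 : X.projFun Z.m z = x :=
      Subtype.ext (Subtype.ext (_root_.funext fun i => Fin.append_left _ _ i))
    have hz2 : X.prodSnd Z.m z = w.1 :=
      Subtype.ext (_root_.funext fun i => Fin.append_right _ _ i)
    have hz3 : X.prodSnd Z.m z ∈ Z.carrier := hz2 ▸ w.2
    have hz4 : (⟨X.prodSnd Z.m z, hz3⟩ : Z.carrier) = w := Subtype.ext hz2
    refine ⟨z, ⟨(hmem z hz3).2 ⟨hz4 ▸ hw, fun i _ => ?_⟩, fun g hg => ?_⟩, hz1⟩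
    · rw [hp i z hz3, hz4, hz1, sub_self]
    · rw [hγ]
      exact (hG _).1 hz3 g hg
  · rintro ⟨z, ⟨hzT, hzG⟩, rfl⟩
    have hz : X.prodSnd Z.m z ∈ Z.carrier := (hG _).2 fun g hg => by
      have := hzG g hg
      rwa [hγ] at this
    obtain ⟨hw, hzp⟩ := (hmem z hz).1 hzT
    refine ⟨_, ⟨_, hw, rfl⟩, Subtype.ext (Subtype.ext (_root_.funext fun i => ?_))⟩
    have := hzp i (Finset.mem_univ i)
    rw [hp i z hz, sub_eq_zero] at this
    exact this.symm

/-- If `f : Y → X` is a map of affinoid varieties and `Σ ⊆ Y` is subanalytic, then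
`f(Σ) ⊆ X` is subanalytic.  In particular, the image `f(Y)` of any map of affinoid
varieties is a subanalytic subset of `X`. -/
theorem image_isSubanalytic
    (K : Type) [NormedField K] [CompleteSpace K] [IsAlgClosed K] [IsUltrametricDist K]
    (Y X : Affinoid K) (f : AffinoidMap Y X) :
    (∀ S : Set Y.carrier, IsSubanalytic Y S → IsSubanalytic X (f.toFun '' S)) ∧
    IsSubanalytic X (Set.range f.toFun) := by
  refine ⟨fun S hS => hS.image f, ?_⟩
  rw [← Set.image_univ]
  exact (isSubanalytic_univ Y).image f

end RigidQE
end
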